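/- Let g ∈ GL_{N+1}(k) and let α = (α_0,…,α_N) ∈ ℤ^{N+1} \ {0} satisfy α_0 ≤ ⋯ ≤ α_N and Σ_{i=0}^N α_i = 0. Assume the point P = g([0:⋯:0:1]) lies on H, i.e. f_g(0,…,0) = 0, and let δ_P := ord_0(f_g) ≥ 1 be the multiplicity of H at P. Then deg_α(F∘g) ≥ (d − 2δ_P)·α_N − δ_P·Σ_{i=1}^{N−1} α_i. -/

import Mathlib

open MvPolynomial

/-- The `α`-degree of a multivariate polynomial `G`: the maximum of `∑ i, m i * α i`
over the monomials `X^m` occurring in `G` with nonzero coefficient (0 if `G = 0`). -/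
noncomputable def adeg {k : Type*} [CommSemiring k] {n : ℕ} (α : Fin n → ℤ)
    (G : MvPolynomial (Fin n) k) : ℤ :=
  if h : G.support.Nonempty then G.support.sup' h (fun m => ∑ i, (m i : ℤ) * α i) else 0

/-- `F ∘ g`: the polynomial obtained from `F` by the substitution `X i ↦ ∑ j, g i j • X j`. -/
noncomputable def substGL {k : Type*} [CommRing k] {n : ℕ}
    (g : Matrix (Fin n) (Fin n) k) (F : MvPolynomial (Fin n) k) :
    MvPolynomial (Fin n) k :=
  aeval (fun i => ∑ j, C (g i j) * X j) F

/-- Dehomogenization with respect to the last variable: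
`G(X_0, …, X_N) ↦ G(x_0, …, x_{N-1}, 1)`. -/
noncomputable def dehom {k : Type*} [CommRing k] {N : ℕ}
    (G : MvPolynomial (Fin (N+1)) k) : MvPolynomial (Fin N) k :=
  aeval (fun i : Fin (N+1) => if h : (i : ℕ) < N then X ⟨i, h⟩ else 1) G

/-- `ord_0 f`: the minimal total degree of a monomial occurring in `f`
with nonzero coefficient (0 if `f = 0`). -/
noncomputable def ord0 {k : Type*} [CommSemiring k] {N : ℕ}
    (f : MvPolynomial (Fin N) k) : ℕ :=
  if h : f.support.Nonempty then f.support.inf' h (fun m => ∑ i, m i) else 0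

/-- The ideal generated by `F` and its partial derivatives, defining the singular
locus `H_sing` of the hypersurface `H = {F = 0}`. -/
noncomputable def jacobianIdeal {k : Type*} [CommRing k] {N : ℕ}
    (F : MvPolynomial (Fin (N+1)) k) : Ideal (MvPolynomial (Fin (N+1)) k) :=
  Ideal.span ({F} ∪ Set.range (fun i => pderiv i F))

theorem MvPolynomial.IsHomogeneous.substGL {k : Type*} [CommRing k] {n d : ℕ} {F : MvPolynomial (Fin n) k}
    (hF : F.IsHomogeneous d) (g : Matrix (Fin n) (Fin n) k) :
    (substGL g F).IsHomogeneous d := by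
  have h := hF.aeval (fun i => ∑ j, C (g i j) * X j) (n := 1) fun i =>
    IsHomogeneous.sum _ _ _ fun j _ => isHomogeneous_C_mul_X _ _
  simpa [_root_.substGL] using h

theorem substGL_substGL {k : Type*} [CommRing k] {n : ℕ} (g h : Matrix (Fin n) (Fin n) k)
    (F : MvPolynomial (Fin n) k) : substGL h (substGL g F) = substGL (g * h) F := by
  unfold substGL
  rw [← AlgHom.comp_apply]
  congr 1
  ext i : 1
  simp only [AlgHom.comp_apply, aeval_X, map_sum, map_mul, algHom_C, algebraMap_eq,
    Matrix.mul_apply, Finset.mul_sum, Finset.sum_mul]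
  rw [Finset.sum_comm]
  simp only [mul_assoc]

theorem substGL_one {k : Type*} [CommRing k] {n : ℕ} (F : MvPolynomial (Fin n) k) :
    substGL 1 F = F := by
  have : (fun i => ∑ j, C ((1 : Matrix (Fin n) (Fin n) k) i j) * X j) =
      (X : Fin n → MvPolynomial (Fin n) k) := by
    ext1 i
    simp [Matrix.one_apply, apply_ite C, ite_mul]
  rw [substGL, this, aeval_X_left_apply]

theorem substGL_ne_zero {k : Type*} [CommRing k] {n : ℕ} {F : MvPolynomial (Fin n) k}
    (hF : F ≠ 0) (g : Matrix.GeneralLinearGroup (Fin n) k) : substGL (g : Matrix _ _ k) F ≠ 0 := by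
  intro h
  apply hF
  have := substGL_substGL (g : Matrix _ _ k) ((g⁻¹ : Matrix.GeneralLinearGroup (Fin n) k)) F
  rw [← Units.val_mul, mul_inv_cancel, Units.val_one, substGL_one, h] at this
  rw [← this, substGL, map_zero]

/-- The exponent vector of the monomial `X^m` after setting the last variable to `1`. -/
noncomputable def initExp {N : ℕ} (m : Fin (N + 1) →₀ ℕ) : Fin N →₀ ℕ :=
  Finsupp.equivFunOnFinite.symm fun i => m i.castSucc

@[simp]
theorem initExp_apply {N : ℕ} (m : Fin (N + 1) →₀ ℕ) (i : Fin N) :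
    initExp m i = m i.castSucc := rfl

theorem dehom_monomial {k : Type*} [CommRing k] {N : ℕ} (m : Fin (N + 1) →₀ ℕ) (c : k) :
    dehom (monomial m c) = monomial (initExp m) c := by
  rw [dehom, aeval_monomial, monomial_eq, Finsupp.prod_fintype _ _ (by simp),
    Finsupp.prod_fintype _ _ (by simp), Fin.prod_univ_castSucc]
  simp [algebraMap_eq]

theorem dehom_eq_sum {k : Type*} [CommRing k] {N : ℕ} (G : MvPolynomial (Fin (N + 1)) k) :
    dehom G = ∑ m ∈ G.support, monomial (initExp m) (coeff m G) := by
  conv_lhs => rw [G.as_sum]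
  simp only [← dehom_monomial]
  exact map_sum (aeval _) _ _

theorem exists_initExp_eq_of_mem_support_dehom {k : Type*} [CommRing k] {N : ℕ}
    {G : MvPolynomial (Fin (N + 1)) k} {p : Fin N →₀ ℕ} (hp : p ∈ (dehom G).support) :
    ∃ m ∈ G.support, initExp m = p := by
  classical
  rw [mem_support_iff, dehom_eq_sum, coeff_sum] at hp
  obtain ⟨m, hm, hne⟩ := Finset.exists_ne_zero_of_sum_ne_zero hp
  rw [coeff_monomial] at hne
  exact ⟨m, hm, by_contra fun h => hne (if_neg h)⟩

theorem MvPolynomial.IsHomogeneous.sum_exponents {k : Type*} [CommSemiring k] {n d : ℕ}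
    {G : MvPolynomial (Fin n) k} (hG : G.IsHomogeneous d) {m : Fin n →₀ ℕ}
    (hm : m ∈ G.support) : ∑ i, m i = d := by
  rw [← hG (mem_support_iff.mp hm), Finsupp.weight_apply, Finsupp.sum_fintype _ _ (by simp)]
  simp

theorem MvPolynomial.IsHomogeneous.dehom_ne_zero {k : Type*} [CommRing k] {N d : ℕ}
    {G : MvPolynomial (Fin (N + 1)) k} (hG : G.IsHomogeneous d) (hG0 : G ≠ 0) :
    dehom G ≠ 0 := by
  classical
  obtain ⟨m, hm⟩ := support_nonempty.mpr hG0
  have hcoeff : coeff (initExp m) (dehom G) = coeff m G := by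
    rw [dehom_eq_sum, coeff_sum, Finset.sum_eq_single_of_mem m hm, coeff_monomial, if_pos rfl]
    intro b hb hbm
    rw [coeff_monomial, if_neg]
    intro heq
    have hcast (i : Fin N) : b i.castSucc = m i.castSucc := DFunLike.congr_fun heq i
    have hlast := (hG.sum_exponents hb).trans (hG.sum_exponents hm).symm
    simp only [Fin.sum_univ_castSucc, hcast, add_right_inj] at hlast
    exact hbm (Finsupp.ext fun i => Fin.lastCases hlast hcast i)
  intro h
  rw [h, coeff_zero] at hcoeff
  exact mem_support_iff.mp hm hcoeff.symm

theorem exists_sum_eq_ord0 {k : Type*} [CommSemiring k] {N : ℕ} {f : MvPolynomial (Fin N) k}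
    (hf : f ≠ 0) : ∃ p ∈ f.support, ∑ i, p i = ord0 f := by
  have h := support_nonempty.mpr hf
  obtain ⟨p, hp, he⟩ := Finset.exists_mem_eq_inf' h fun m : Fin N →₀ ℕ => ∑ i, m i
  exact ⟨p, hp, by rw [ord0, dif_pos h, he]⟩

theorem le_adeg {k : Type*} [CommSemiring k] {n : ℕ} (α : Fin n → ℤ)
    {G : MvPolynomial (Fin n) k} {m : Fin n →₀ ℕ} (hm : m ∈ G.support) :
    ∑ i, (m i : ℤ) * α i ≤ adeg α G := by
  rw [adeg, dif_pos ⟨m, hm⟩]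
  exact Finset.le_sup' (fun m : Fin n →₀ ℕ => ∑ i, (m i : ℤ) * α i) hm

theorem sum_eq_zero_add_last_add_sum_filter {M : Type*} [AddCommMonoid M] {N : ℕ} (hN : 1 ≤ N)
    (α : Fin (N + 1) → M) :
    ∑ i, α i = α 0 + (α (Fin.last N) + ∑ i ∈ Finset.univ.filter
      (fun i : Fin (N + 1) => 1 ≤ (i : ℕ) ∧ (i : ℕ) ≤ N - 1), α i) := by
  rw [← Finset.sum_insert, ← Finset.sum_insert]
  · congr 1
    ext i
    simp only [Finset.mem_univ, Finset.mem_insert, Finset.mem_filter, Fin.ext_iff,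
      Fin.val_zero, Fin.val_last, true_and, true_iff]
    omega
  · simp only [Finset.mem_insert, Finset.mem_filter, Fin.ext_iff, Fin.val_zero, Fin.val_last]
    omega
  · simp only [Finset.mem_filter, Fin.val_last]
    omega

/-- If `P = g([0:⋯:0:1])` lies on `H = {F = 0}` (i.e. `f_g(0,…,0) = 0`) and `δP` is
the multiplicity of `H` at `P`, then
`deg_α (F∘g) ≥ (d - 2δP)·α_N - δP·∑_{i=1}^{N-1} α_i`. -/
theorem adeg_ge_of_mem_mult {k : Type*} [Field k] [IsAlgClosed k]
    {N d : ℕ} (hN : 1 ≤ N) (hd : 2 ≤ d)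
    (F : MvPolynomial (Fin (N+1)) k) (hF0 : F ≠ 0) (hFhom : F.IsHomogeneous d)
    (g : Matrix.GeneralLinearGroup (Fin (N+1)) k)
    (α : Fin (N+1) → ℤ) (hα0 : α ≠ 0) (hmono : Monotone α) (hsum : ∑ i, α i = 0)
    (heval : MvPolynomial.eval (fun _ : Fin N => (0 : k)) (dehom (substGL (↑g) F)) = 0)
    (δP : ℕ) (hδP : δP = ord0 (dehom (substGL (↑g) F))) :
    ((d : ℤ) - 2 * δP) * α (Fin.last N)
      - (δP : ℤ) * (∑ i ∈ Finset.univ.filter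
          (fun i : Fin (N+1) => 1 ≤ (i : ℕ) ∧ (i : ℕ) ≤ N - 1), α i)
      ≤ adeg α (substGL (↑g) F) := by
  have hGhom := hFhom.substGL (g : Matrix _ _ k)
  obtain ⟨p, hp, hpδ⟩ := exists_sum_eq_ord0 (hGhom.dehom_ne_zero (substGL_ne_zero hF0 g))
  obtain ⟨m, hm, rfl⟩ := exists_initExp_eq_of_mem_support_dehom hp
  rw [← hδP] at hpδ
  refine le_trans ?_ (le_adeg α hm)
  have hdeg := hGhom.sum_exponents hm
  simp only [initExp_apply] at hpδ
  rw [Fin.sum_univ_castSucc, hpδ] at hdeg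
  rw [sum_eq_zero_add_last_add_sum_filter hN] at hsum
  have hle : (δP : ℤ) * α 0 ≤ ∑ i : Fin N, (m i.castSucc : ℤ) * α i.castSucc := by
    rw [← hpδ, Nat.cast_sum, Finset.sum_mul]
    exact Finset.sum_le_sum fun i _ =>
      mul_le_mul_of_nonneg_left (hmono (Fin.zero_le _)) (Nat.cast_nonneg _)
  rw [Fin.sum_univ_castSucc]
  have hlast : (d : ℤ) = δP + m (Fin.last N) := by exact_mod_cast hdeg.symm
  refine le_trans (le_of_eq ?_) (add_le_add_left hle _)
  rw [hlast]
  linear_combination (-(δP : ℤ)) * hsum
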